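/- arXiv:1906.02237 — 2 statements merged into one kernel-verified Lean document; each statement's English description precedes it below -/
import Mathlib

section
/- Suppose the weight data (c; a₁,…,a_s; b₁,…,b_t) is tightly constrained with lower bound r₀. Then there exists R ∈ ℤ≥0 such that for every integer q ≥ R one has the difference equation cap(q + λ) = cap(q) + q + L − 1. -/
open scoped BigOperators

noncomputable section

/-- `C(T) = δ(δ+3)/2 − Σᵢ αᵢ(αᵢ+1)/2 − Σⱼ βⱼ(βⱼ+1)/2` (each division is exact). -/
def Cfun (s t : ℕ) (T : ℤ × (Fin s → ℤ) × (Fin t → ℤ)) : ℤ :=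
  T.1 * (T.1 + 3) / 2 - (∑ i, T.2.1 i * (T.2.1 i + 1) / 2)
    - (∑ j, T.2.2 j * (T.2.2 j + 1) / 2)

/-- `E(T) = δc − Σᵢ αᵢaᵢ − Σⱼ βⱼbⱼ`. -/
def Efun (s t : ℕ) (c : ℤ) (a : Fin s → ℤ) (b : Fin t → ℤ)
    (T : ℤ × (Fin s → ℤ) × (Fin t → ℤ)) : ℤ :=
  T.1 * c - (∑ i, T.2.1 i * a i) - (∑ j, T.2.2 j * b j)

/-- Tuples with all entries nonnegative. -/
def NonnegT (s t : ℕ) (T : ℤ × (Fin s → ℤ) × (Fin t → ℤ)) : Prop :=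
  0 ≤ T.1 ∧ (∀ i, 0 ≤ T.2.1 i) ∧ (∀ j, 0 ≤ T.2.2 j)

/-- `M(r)`: the maximum of `C(T)` over nonnegative tuples with `E(T) ≤ r`. -/
def Mfun (s t : ℕ) (c : ℤ) (a : Fin s → ℤ) (b : Fin t → ℤ) (r : ℤ) : ℤ :=
  sSup {m : ℤ | ∃ T, NonnegT s t T ∧ Efun s t c a b T ≤ r ∧ Cfun s t T = m}

/-- The cap function `cap(r) = 1 + M(r)`. -/
def capW (s t : ℕ) (c : ℤ) (a : Fin s → ℤ) (b : Fin t → ℤ) (r : ℤ) : ℤ :=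
  1 + Mfun s t c a b r

/-- `L = (c+1)(c+2)/2 − Σᵢ aᵢ(aᵢ+1)/2 − Σⱼ bⱼ(bⱼ+1)/2`. -/
def Lval (s t : ℕ) (c : ℤ) (a : Fin s → ℤ) (b : Fin t → ℤ) : ℤ :=
  (c + 1) * (c + 2) / 2 - (∑ i, a i * (a i + 1) / 2) - (∑ j, b j * (b j + 1) / 2)

/-- `λ = c² − Σᵢ aᵢ² − Σⱼ bⱼ²`. -/
def lamW (s t : ℕ) (c : ℤ) (a : Fin s → ℤ) (b : Fin t → ℤ) : ℤ :=
  c ^ 2 - (∑ i, a i ^ 2) - (∑ j, b j ^ 2)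

/-- The weight data is tightly constrained with lower bound `r₀`: for every
`r ≥ r₀` the maximum `M(r)` is attained at a tuple with `E(T) = r`. -/
def TightW (s t : ℕ) (c : ℤ) (a : Fin s → ℤ) (b : Fin t → ℤ) (r₀ : ℤ) : Prop :=
  ∀ r : ℤ, r₀ ≤ r → ∃ T, NonnegT s t T ∧ Efun s t c a b T = r ∧
    Cfun s t T = Mfun s t c a b r

/-- `c_k`: the minimum of `E(T)` over nonnegative tuples with `C(T) ≥ k`. -/
def ckW (s t : ℕ) (c : ℤ) (a : Fin s → ℤ) (b : Fin t → ℤ) (k : ℕ) : ℤ :=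
  sInf {e : ℤ | ∃ T, NonnegT s t T ∧ (k : ℤ) ≤ Cfun s t T ∧ Efun s t c a b T = e}


lemma aux_two_div (x : ℤ) : 2 * (x * (x + 1) / 2) = x * (x + 1) :=
  Int.mul_ediv_cancel' (Int.even_mul_succ_self x).two_dvd

lemma aux_two_div3 (x : ℤ) : 2 * (x * (x + 3) / 2) = x * (x + 3) := by
  apply Int.mul_ediv_cancel'
  have h := (Int.even_mul_succ_self x).two_dvd
  have : x * (x + 3) = x * (x + 1) + 2 * x := by ring
  rw [this]
  exact dvd_add h (Dvd.intro _ rfl)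

lemma two_C (s t : ℕ) (T : ℤ × (Fin s → ℤ) × (Fin t → ℤ)) :
    2 * Cfun s t T = T.1 * (T.1 + 3) - (∑ i, T.2.1 i * (T.2.1 i + 1))
      - ∑ j, T.2.2 j * (T.2.2 j + 1) := by
  unfold Cfun
  rw [mul_sub, mul_sub, Finset.mul_sum, Finset.mul_sum, aux_two_div3]
  simp only [aux_two_div]

lemma L_eq (s t : ℕ) (c : ℤ) (a : Fin s → ℤ) (b : Fin t → ℤ) :
    Lval s t c a b = Cfun s t (c, a, b) + 1 := by
  unfold Lval Cfun
  have : (c + 1) * (c + 2) = c * (c + 3) + 1 * 2 := by ring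
  rw [this, Int.add_mul_ediv_right _ _ (by norm_num)]
  ring

lemma E_shift (s t : ℕ) (c : ℤ) (a : Fin s → ℤ) (b : Fin t → ℤ)
    (T : ℤ × (Fin s → ℤ) × (Fin t → ℤ)) :
    Efun s t c a b (T + (c, a, b)) = Efun s t c a b T + lamW s t c a b := by
  unfold Efun lamW
  simp only [Prod.fst_add, Prod.snd_add, Pi.add_apply, add_mul, Finset.sum_add_distrib, pow_two]
  ring

lemma C_shift (s t : ℕ) (c : ℤ) (a : Fin s → ℤ) (b : Fin t → ℤ)
    (T : ℤ × (Fin s → ℤ) × (Fin t → ℤ)) :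
    Cfun s t (T + (c, a, b)) = Cfun s t T + Efun s t c a b T + Lval s t c a b - 1 := by
  rw [L_eq]
  have h : 2 * Cfun s t (T + (c, a, b)) =
      2 * Cfun s t T + 2 * Efun s t c a b T + 2 * Cfun s t (c, a, b) := by
    rw [two_C, two_C, two_C]
    unfold Efun
    have e1 : ∀ {n : ℕ} (x y : Fin n → ℤ), ∑ i, (x i + y i) * (x i + y i + 1) =
        ∑ i, x i * (x i + 1) + ∑ i, y i * (y i + 1) + 2 * ∑ i, x i * y i := by
      intro n x y
      rw [Finset.mul_sum, ← Finset.sum_add_distrib, ← Finset.sum_add_distrib]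
      exact Finset.sum_congr rfl fun i _ => by ring
    simp only [Prod.fst_add, Prod.snd_add, Pi.add_apply, e1]
    ring
  linarith

/-- Core inequality. -/
lemma core {ι : Type*} [Fintype ι] (c lam : ℤ) (w : ι → ℤ) (hc : 0 < c)
    (hl : lam = c ^ 2 - ∑ i, w i ^ 2) (hlam : 0 < lam) (v0 : ℤ) (v : ι → ℤ) (mu : ℤ) (hmu : 0 ≤ mu)
    (h1 : v0 * c ≤ ∑ i, v i * w i) (h2 : (v0 * c) ^ 2 ≤ (∑ i, v i * w i) ^ 2) :
    2 * c ^ 2 * (v0 ^ 2 - ∑ i, v i ^ 2 + mu * (3 * v0 - ∑ i, v i)) ≤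
      -lam * ∑ i, v i ^ 2 + mu ^ 2 * c ^ 2 * ∑ i, (3 * w i - c) ^ 2 := by
  have cs := Finset.sum_mul_sq_le_sq_mul_sq Finset.univ v w
  have hS : 0 ≤ ∑ i, v i ^ 2 := Finset.sum_nonneg fun i _ => sq_nonneg _
  have am : 2 * (mu * c) * (3 * ∑ i, v i * w i - c * ∑ i, v i) ≤
      ∑ i, v i ^ 2 + mu ^ 2 * c ^ 2 * ∑ i, (3 * w i - c) ^ 2 := by
    have : 2 * (mu * c) * (3 * ∑ i, v i * w i - c * ∑ i, v i) =
        ∑ i, 2 * (mu * c) * (v i * (3 * w i - c)) := by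
      rw [← Finset.mul_sum, Finset.mul_sum, Finset.mul_sum, ← Finset.sum_sub_distrib]
      congr 1
      exact Finset.sum_congr rfl fun i _ => by ring
    rw [this, Finset.mul_sum, ← Finset.sum_add_distrib]
    refine Finset.sum_le_sum fun i _ => ?_
    nlinarith [sq_nonneg (v i - mu * c * (3 * w i - c))]
  have hW : ∑ i, w i ^ 2 = c ^ 2 - lam := by linarith
  rw [hW] at cs
  set S := ∑ i, v i ^ 2
  set V := ∑ i, v i * w i
  have h3 : mu * c * (v0 * c) ≤ mu * c * V := mul_le_mul_of_nonneg_left h1 (by positivity)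
  have h4 : S ≤ lam * S := by nlinarith
  nlinarith

lemma ident {ι : Type*} [Fintype ι] (c lam : ℤ) (w : ι → ℤ)
    (hl : lam = c ^ 2 - ∑ i, w i ^ 2) (d : ℤ) (x : ι → ℤ) (E : ℤ)
    (hE : E = d * c - ∑ i, x i * w i) :
    ((lam * d - E * c) * c = ∑ i, (lam * x i - E * w i) * w i) ∧
    lam * (lam * (d * (d + 3) - ∑ i, x i * (x i + 1)) - E ^ 2 - E * (3 * c - ∑ i, w i)) =
      (lam * d - E * c) ^ 2 - ∑ i, (lam * x i - E * w i) ^ 2 +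
        lam * (3 * (lam * d - E * c) - ∑ i, (lam * x i - E * w i)) := by
  have e1 : ∑ i, (lam * x i - E * w i) * w i = lam * ∑ i, x i * w i - E * ∑ i, w i ^ 2 := by
    rw [Finset.mul_sum, Finset.mul_sum, ← Finset.sum_sub_distrib]
    exact Finset.sum_congr rfl fun i _ => by ring
  have e2 : ∑ i, (lam * x i - E * w i) ^ 2 = lam ^ 2 * ∑ i, x i ^ 2
      - 2 * lam * E * ∑ i, x i * w i + E ^ 2 * ∑ i, w i ^ 2 := by
    rw [Finset.mul_sum, Finset.mul_sum, Finset.mul_sum, ← Finset.sum_sub_distrib,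
      ← Finset.sum_add_distrib]
    exact Finset.sum_congr rfl fun i _ => by ring
  have e3 : ∑ i, (lam * x i - E * w i) = lam * ∑ i, x i - E * ∑ i, w i := by
    rw [Finset.mul_sum, Finset.mul_sum, ← Finset.sum_sub_distrib]
  have e4 : ∑ i, x i * (x i + 1) = ∑ i, x i ^ 2 + ∑ i, x i := by
    rw [← Finset.sum_add_distrib]
    exact Finset.sum_congr rfl fun i _ => by ring
  have hW : ∑ i, w i ^ 2 = c ^ 2 - lam := by linarith
  have hX : ∑ i, x i * w i = d * c - E := by linarith
  rw [e1, e2, e3, e4, hW, hX]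
  constructor <;> ring

/-- Upper bound on `2C` for bounded `E`. -/
lemma bound_G {ι : Type*} [Fintype ι] (c lam : ℤ) (w : ι → ℤ) (hc : 0 < c)
    (hl : lam = c ^ 2 - ∑ i, w i ^ 2) (hlam : 0 < lam) (r : ℤ) :
    ∃ B : ℤ, ∀ (d : ℤ) (x : ι → ℤ), 0 ≤ d → d * c - ∑ i, x i * w i ≤ r →
      d * (d + 3) - ∑ i, x i * (x i + 1) ≤ B := by
  set N := ∑ i, (3 * w i - c) ^ 2 with hN
  have hN0 : 0 ≤ N := Finset.sum_nonneg fun i _ => sq_nonneg _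
  refine ⟨c ^ 2 * N + lam ^ 2 * c ^ 2 * N + r ^ 2 + |r| * |3 * c - ∑ i, w i|, ?_⟩
  intro d x hd hr
  have e4 : ∑ i, x i * (x i + 1) = ∑ i, x i ^ 2 + ∑ i, x i := by
    rw [← Finset.sum_add_distrib]
    exact Finset.sum_congr rfl fun i _ => by ring
  have hc2 : 1 ≤ c ^ 2 := by nlinarith
  have p1 : 0 ≤ |r| * |3 * c - ∑ i, w i| := by positivity
  have p2 : 0 ≤ c ^ 2 * N := by positivity
  have p3 : 0 ≤ lam ^ 2 * c ^ 2 * N := by positivity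
  rcases le_total (d * c - ∑ i, x i * w i) 0 with h | h
  · have h0 : 0 ≤ d * c := by positivity
    have k := core c lam w hc hl hlam d x 1 (by norm_num) (by linarith)
      (pow_le_pow_left₀ h0 (by linarith) 2)
    have hS : 0 ≤ lam * ∑ i, x i ^ 2 :=
      mul_nonneg hlam.le (Finset.sum_nonneg fun i _ => sq_nonneg _)
    rw [← hN] at k
    rw [e4]
    have : d * (d + 3) - (∑ i, x i ^ 2 + ∑ i, x i) = d ^ 2 - ∑ i, x i ^ 2 + 1 * (3 * d - ∑ i, x i) := by
      ring
    rw [this]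
    set Z := d ^ 2 - ∑ i, x i ^ 2 + 1 * (3 * d - ∑ i, x i)
    by_cases hZ : Z ≤ 0
    · nlinarith
    · nlinarith
  · set E := d * c - ∑ i, x i * w i with hE
    obtain ⟨i1, i2⟩ := ident c lam w hl d x E hE
    have k := core c lam w hc hl hlam _ _ lam hlam.le i1.le (by rw [i1])
    rw [← i2, ← hN] at k
    have hS : 0 ≤ lam * ∑ i, (lam * x i - E * w i) ^ 2 :=
      mul_nonneg hlam.le (Finset.sum_nonneg fun i _ => sq_nonneg _)
    have q1 : E ^ 2 ≤ r ^ 2 := pow_le_pow_left₀ h hr 2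
    have q2 : E * (3 * c - ∑ i, w i) ≤ |r| * |3 * c - ∑ i, w i| := by
      calc E * (3 * c - ∑ i, w i) ≤ E * |3 * c - ∑ i, w i| :=
            mul_le_mul_of_nonneg_left (le_abs_self _) h
        _ ≤ _ := mul_le_mul_of_nonneg_right (hr.trans (le_abs_self _)) (abs_nonneg _)
    set G := d * (d + 3) - ∑ i, x i * (x i + 1)
    set U := 3 * c - ∑ i, w i
    set F := lam * G - E ^ 2 - E * U with hF
    have hFb : F ≤ lam ^ 2 * c ^ 2 * N := by
      by_contra hcon
      push Not at hcon
      have f0 : 0 < F := by linarith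
      have f1 : F ≤ lam * F := by nlinarith
      have f2 : 0 < lam * F := by positivity
      have f3 : lam * F ≤ c ^ 2 * (lam * F) := by nlinarith
      have f4 : 2 * c ^ 2 * (lam * F) ≤ lam ^ 2 * c ^ 2 * N := by linarith
      have f5 : 2 * c ^ 2 * (lam * F) = 2 * (c ^ 2 * (lam * F)) := by ring
      linarith
    by_cases hG : G ≤ 0
    · linarith [sq_nonneg r]
    · have g1 : G ≤ lam * G := by
        have := mul_le_mul_of_nonneg_right (show (1:ℤ) ≤ lam from hlam) (show 0 ≤ G by omega)
        linarith
      linarith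

/-- Coordinates of near-optimal tuples. -/
lemma coord {ι : Type*} [Fintype ι] (c lam : ℤ) (w : ι → ℤ) (hc : 0 < c)
    (hl : lam = c ^ 2 - ∑ i, w i ^ 2) (hlam : 0 < lam) (K : ℤ) :
    ∃ D : ℤ, 0 ≤ D ∧ ∀ (d : ℤ) (x : ι → ℤ) (E : ℤ), E = d * c - ∑ i, x i * w i →
      -K ≤ lam * (d * (d + 3) - ∑ i, x i * (x i + 1)) - E ^ 2 - E * (3 * c - ∑ i, w i) →
      E * c - D ≤ lam * d ∧ ∀ i, E * w i - D ≤ lam * x i := by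
  set N := ∑ i, (3 * w i - c) ^ 2 with hN
  have hN0 : 0 ≤ N := Finset.sum_nonneg fun i _ => sq_nonneg _
  refine ⟨lam ^ 2 * c ^ 2 * N + 2 * c ^ 2 * lam * |K|, by positivity, ?_⟩
  intro d x E hE hK
  obtain ⟨i1, i2⟩ := ident c lam w hl d x E hE
  have k := core c lam w hc hl hlam _ _ lam hlam.le i1.le (by rw [i1])
  rw [← i2, ← hN] at k
  have cs := Finset.sum_mul_sq_le_sq_mul_sq Finset.univ (fun i => lam * x i - E * w i) w
  rw [← i1] at cs
  have hS1 : ∀ i, (lam * x i - E * w i) ^ 2 ≤ ∑ i, (lam * x i - E * w i) ^ 2 := fun i =>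
    Finset.single_le_sum (f := fun i => (lam * x i - E * w i) ^ 2)
      (fun i _ => sq_nonneg _) (Finset.mem_univ i)
  have hS : 0 ≤ ∑ i, (lam * x i - E * w i) ^ 2 := Finset.sum_nonneg fun i _ => sq_nonneg _
  have hW : ∑ i, w i ^ 2 = c ^ 2 - lam := by linarith
  rw [hW] at cs
  set S := ∑ i, (lam * x i - E * w i) ^ 2
  set F := lam * (d * (d + 3) - ∑ i, x i * (x i + 1)) - E ^ 2 - E * (3 * c - ∑ i, w i)
  have g1 : -|K| ≤ F := by linarith [le_abs_self K]
  have g2 : 2 * c ^ 2 * lam * (-|K|) ≤ 2 * c ^ 2 * lam * F :=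
    mul_le_mul_of_nonneg_left g1 (by positivity)
  have g3 : S ≤ lam * S := by nlinarith
  have hSD : S ≤ lam ^ 2 * c ^ 2 * N + 2 * c ^ 2 * lam * |K| := by linarith
  have fin : ∀ y : ℤ, y ^ 2 ≤ S → -S ≤ y := fun y hy => by
    have := Int.le_self_sq (-y)
    nlinarith
  constructor
  · have : (lam * d - E * c) ^ 2 ≤ S := by
      have : c ^ 2 * (lam * d - E * c) ^ 2 ≤ c ^ 2 * S := by nlinarith
      exact le_of_mul_le_mul_left this (by positivity)
    have := fin _ this
    linarith
  · intro i
    have := fin _ (hS1 i)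
    linarith

/-- For tightly constrained weight data there is `R ∈ ℤ≥0`
such that `cap(q + λ) = cap(q) + q + L − 1` for all integers `q ≥ R`. -/
theorem capW_difference_equation (s t : ℕ) (c : ℤ) (a : Fin s → ℤ) (b : Fin t → ℤ)
    (hc : 0 < c) (ha : ∀ i, 0 < a i) (hb : ∀ j, 0 < b j)
    (hlam : 0 < lamW s t c a b)
    (r₀ : ℤ) (hr₀ : 0 ≤ r₀) (htight : TightW s t c a b r₀) :
    ∃ R : ℕ, ∀ q : ℤ, (R : ℤ) ≤ q →
      capW s t c a b (q + lamW s t c a b) =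
        capW s t c a b q + q + Lval s t c a b - 1 := by
  set lam := lamW s t c a b with hlamdef
  let w : Fin s ⊕ Fin t → ℤ := Sum.elim a b
  have hl : lam = c ^ 2 - ∑ i, w i ^ 2 := by
    simp only [w, hlamdef, lamW, Fintype.sum_sum_type, Sum.elim_inl, Sum.elim_inr]; ring
  have hC : ∀ T : ℤ × (Fin s → ℤ) × (Fin t → ℤ), 2 * Cfun s t T =
      T.1 * (T.1 + 3) - ∑ i, (Sum.elim T.2.1 T.2.2) i * ((Sum.elim T.2.1 T.2.2) i + 1) := by
    intro T
    rw [two_C]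
    simp only [Fintype.sum_sum_type, Sum.elim_inl, Sum.elim_inr]; ring
  have hE : ∀ T : ℤ × (Fin s → ℤ) × (Fin t → ℤ), Efun s t c a b T =
      T.1 * c - ∑ i, (Sum.elim T.2.1 T.2.2) i * w i := by
    intro T
    simp only [w, Efun, Fintype.sum_sum_type, Sum.elim_inl, Sum.elim_inr]; ring
  have hle : ∀ r T, NonnegT s t T → Efun s t c a b T ≤ r → Cfun s t T ≤ Mfun s t c a b r := by
    intro r T hT hTE
    unfold Mfun
    refine le_csSup ?_ ⟨T, hT, hTE, rfl⟩
    obtain ⟨B, hB⟩ := bound_G c lam w hc hl hlam r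
    refine ⟨|B|, ?_⟩
    rintro m ⟨T', h1, h2, rfl⟩
    have := hB T'.1 (Sum.elim T'.2.1 T'.2.2) h1.1 (by rw [← hE]; exact h2)
    rw [← hC] at this
    have h3 := le_abs_self B
    have h4 := abs_nonneg B
    omega
  have hge : ∀ r, r₀ ≤ r → Mfun s t c a b r + r + Lval s t c a b - 1 ≤ Mfun s t c a b (r + lam) := by
    intro r hr
    obtain ⟨T, hT, hTE, hTC⟩ := htight r hr
    have := hle (r + lam) (T + (c, a, b))
      ⟨add_nonneg hT.1 hc.le, fun i => add_nonneg (hT.2.1 i) (ha i).le,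
        fun j => add_nonneg (hT.2.2 j) (hb j).le⟩ (by rw [E_shift, hTE])
    rw [C_shift, hTE, hTC] at this
    exact this
  -- the normalized function
  set U := 3 * c - ∑ i, w i with hU
  have hL : 2 * (Lval s t c a b - 1) = lam + U := by
    have h1 : 2 * (Lval s t c a b - 1) = 2 * Cfun s t (c, a, b) := by rw [L_eq]; ring
    have e4 : ∑ i, w i * (w i + 1) = ∑ i, w i ^ 2 + ∑ i, w i := by
      rw [← Finset.sum_add_distrib]
      exact Finset.sum_congr rfl fun i _ => by ring
    rw [h1, hC, hl, hU]
    change c * (c + 3) - ∑ i, w i * (w i + 1) = _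
    rw [e4]; ring
  let phi : ℤ → ℤ := fun r => lam * (2 * Mfun s t c a b r) - r ^ 2 - r * U
  have hphi : ∀ r, r₀ ≤ r → phi r ≤ phi (r + lam) := by
    intro r hr
    have h := hge r hr
    have h2 : lam * (2 * Mfun s t c a b r + 2 * r + (lam + U)) ≤
        lam * (2 * Mfun s t c a b (r + lam)) :=
      mul_le_mul_of_nonneg_left (by linarith) hlam.le
    simp only [phi]
    nlinarith
  obtain ⟨K, hK⟩ : ∃ K, ∀ r ∈ Finset.Ico r₀ (r₀ + lam), -K ≤ phi r := by
    obtain ⟨m, hm⟩ := ((Finset.Ico r₀ (r₀ + lam)).image phi).bddBelow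
    refine ⟨-m, fun r hr => ?_⟩
    rw [neg_neg]
    exact hm (Finset.mem_coe.2 (Finset.mem_image_of_mem _ hr))
  have hphiK : ∀ r, r₀ ≤ r → -K ≤ phi r := by
    have key : ∀ n : ℕ, ∀ r, r₀ ≤ r → r - r₀ ≤ n → -K ≤ phi r := by
      intro n
      induction n with
      | zero =>
        intro r h1 h2
        exact hK r (Finset.mem_Ico.2 ⟨h1, by push_cast at h2; linarith⟩)
      | succ n ih =>
        intro r h1 h2
        by_cases h : r < r₀ + lam
        · exact hK r (Finset.mem_Ico.2 ⟨h1, h⟩)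
        · have := hphi (r - lam) (by linarith)
          rw [sub_add_cancel] at this
          refine le_trans (ih (r - lam) (by linarith) ?_) this
          push_cast at h2
          linarith
    intro r hr
    exact key (r - r₀).toNat r hr (Int.self_le_toNat _)
  obtain ⟨D, hD0, hD⟩ := coord c lam w hc hl hlam K
  refine ⟨(max r₀ D).toNat, fun q hq => ?_⟩
  have hq1 : max r₀ D ≤ q := (Int.self_le_toNat _).trans hq
  have hqr : r₀ ≤ q := (le_max_left _ _).trans hq1
  have hqD : D ≤ q := (le_max_right _ _).trans hq1
  have hmain : Mfun s t c a b (q + lam) ≤ Mfun s t c a b q + q + Lval s t c a b - 1 := by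
    obtain ⟨T, hT, hTE, hTC⟩ := htight (q + lam) (by linarith)
    obtain ⟨d1, d2⟩ := hD T.1 (Sum.elim T.2.1 T.2.2) (q + lam) (by rw [← hE, hTE])
      (by rw [← hC, hTC]; exact hphiK (q + lam) (by linarith))
    have gen : ∀ y z : ℤ, 0 < z → (q + lam) * z - D ≤ lam * y → 0 ≤ y - z := by
      intro y z hz h
      have : 0 ≤ lam * (y - z) := by nlinarith
      exact nonneg_of_mul_nonneg_right this hlam
    have hsub : T - (c, a, b) + (c, a, b) = T := sub_add_cancel _ _
    have hEs := E_shift s t c a b (T - (c, a, b))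
    have hCs := C_shift s t c a b (T - (c, a, b))
    rw [hsub] at hEs hCs
    have hEq : Efun s t c a b (T - (c, a, b)) = q := by linarith
    have := hle q (T - (c, a, b))
      ⟨gen _ _ hc d1, fun i => gen _ _ (ha i) (d2 (Sum.inl i)),
        fun j => gen _ _ (hb j) (d2 (Sum.inr j))⟩ hEq.le
    linarith
  have := hge q hqr
  unfold capW
  linarith

end
end

section
/- For every compact convex polygon Ω ⊂ ℝ² with nonempty interior, the Ω-perimeter of Ω itself equals twice its area: ℓ_Ω(∂Ω) = 2·vol(Ω), where vol denotes two-dimensional Lebesgue measure. -/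
open scoped BigOperators Pointwise

noncomputable section

/-- Planar cross product `det(v,p) = v₁p₂ − v₂p₁`. -/
def det2 (v p : ℝ × ℝ) : ℝ := v.1 * p.2 - v.2 * p.1

/-- The `Ω`-length of a vector `v`: `max_{p ∈ Ω} det(v,p)`. -/
def omegaLen (Ω : Set (ℝ × ℝ)) (v : ℝ × ℝ) : ℝ := sSup (det2 v '' Ω)

/-- A (possibly degenerate) compact convex polygon with vertices listed in
clockwise order: a cyclic (period `n`) list of pairwise distinct vertices such
that the polygon (the convex hull of the vertices) lies in the right
half-plane of every directed edge. -/
structure ClockPolygon where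
  n : ℕ
  npos : 0 < n
  verts : ℕ → ℝ × ℝ
  periodic : ∀ i, verts (i + n) = verts i
  inj : ∀ i j, i < n → j < n → verts i = verts j → i = j
  clockwise : ∀ i, ∀ q ∈ convexHull ℝ (Set.range verts),
      det2 (verts (i + 1) - verts i) (q - verts i) ≤ 0

/-- The underlying point set of a polygon. -/
def ClockPolygon.body (P : ClockPolygon) : Set (ℝ × ℝ) :=
  convexHull ℝ (Set.range P.verts)

/-- The `Ω`-perimeter `ℓ_Ω(∂Λ)`: the sum of the `Ω`-lengths of the edge
vectors of `Λ`. -/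
def omegaPerim (Ω : Set (ℝ × ℝ)) (P : ClockPolygon) : ℝ :=
  ∑ i ∈ Finset.range P.n, omegaLen Ω (P.verts (i + 1) - P.verts i)

/-- Lattice points of the plane. -/
def IsLatticePt (p : ℝ × ℝ) : Prop := (∃ m : ℤ, p.1 = m) ∧ (∃ m : ℤ, p.2 = m)

/-- Rational points of the plane. -/
def IsRationalPt (p : ℝ × ℝ) : Prop := (∃ q : ℚ, p.1 = q) ∧ (∃ q : ℚ, p.2 = q)

/-- The number of lattice points in a set. -/
def latticeCount (S : Set (ℝ × ℝ)) : ℕ := {p ∈ S | IsLatticePt p}.ncard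

/-- Competitor convex lattice domains: convex hulls of finite nonempty sets of
lattice points in `ℝ≥0²`, containing the origin and closed under taking
coordinate rectangles. -/
def IsCompetitor (P : ClockPolygon) : Prop :=
  (∀ i, IsLatticePt (P.verts i)) ∧
  (∀ i, 0 ≤ (P.verts i).1 ∧ 0 ≤ (P.verts i).2) ∧
  (((0 : ℝ), (0 : ℝ)) ∈ P.body) ∧
  ∀ q ∈ P.body, Set.Icc (0 : ℝ) q.1 ×ˢ Set.Icc (0 : ℝ) q.2 ⊆ P.body

/-- ECH capacities of `X_Ω`, via Cristofaro-Gardiner's combinatorial formula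
(taken as a definition). -/
def echCap (Ω : Set (ℝ × ℝ)) (k : ℕ) : ℝ :=
  sInf { r | ∃ P : ClockPolygon, IsCompetitor P ∧
      latticeCount P.body = k + 1 ∧ omegaPerim Ω P = r }

/-- The cap function `cap_{X_Ω}(r) = #{k : c_k(X_Ω) ≤ r}`. -/
def capFn (Ω : Set (ℝ × ℝ)) (r : ℝ) : ℕ := {k : ℕ | echCap Ω k ≤ r}.ncard

/-- A convex domain: a convex polygon in `ℝ≥0²` with nonempty interior,
containing the origin and closed under taking coordinate rectangles. -/
structure ConvexDomain where
  P : ClockPolygon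
  int_nonempty : (interior P.body).Nonempty
  nonneg : ∀ q ∈ P.body, 0 ≤ q.1 ∧ 0 ≤ q.2
  zero_mem : (((0 : ℝ), (0 : ℝ)) ∈ P.body)
  rect : ∀ q ∈ P.body, Set.Icc (0 : ℝ) q.1 ×ˢ Set.Icc (0 : ℝ) q.2 ⊆ P.body

def ConvexDomain.body (Ω : ConvexDomain) : Set (ℝ × ℝ) := Ω.P.body

/-- A convex lattice domain: all vertices are lattice points. -/
def ConvexDomain.IsLattice (Ω : ConvexDomain) : Prop :=
  ∀ i, IsLatticePt (Ω.P.verts i)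

/-- A rational convex domain: all vertices are rational points. -/
def ConvexDomain.IsRational (Ω : ConvexDomain) : Prop :=
  ∀ i, IsRationalPt (Ω.P.verts i)

/-- `X_Ω` is tightly constrained with lower bound `r₀` if every integer
`r ≥ r₀` is a value `c_k(X_Ω)`. -/
def TightlyConstrained (Ω : ConvexDomain) (r₀ : ℕ) : Prop :=
  ∀ r : ℕ, r₀ ≤ r → ∃ k : ℕ, echCap Ω.body k = r

/-- Every (nonzero) edge of `Q` is parallel to an edge of `P`. -/
def EdgesParallel (Q P : ClockPolygon) : Prop :=
  ∀ i < Q.n, Q.verts (i + 1) - Q.verts i ≠ 0 →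
    ∃ j < P.n, ∃ t : ℝ, t ≠ 0 ∧
      Q.verts (i + 1) - Q.verts i = t • (P.verts (j + 1) - P.verts j)

/-- Euclidean inner product on the plane. -/
def dot2 (u p : ℝ × ℝ) : ℝ := u.1 * p.1 + u.2 * p.2

/-- The dual-norm value `max_{p ∈ K} u·p` (the support function of `K`). -/
def dualLen (K : Set (ℝ × ℝ)) (u : ℝ × ℝ) : ℝ := sSup (dot2 u '' K)

/-- The pseudonorm length `ℓ'_Ω(∂Λ)` with respect to a translated body `K`. -/
def dualPerim (K : Set (ℝ × ℝ)) (P : ClockPolygon) : ℝ :=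
  ∑ i ∈ Finset.range P.n, dualLen K (P.verts (i + 1) - P.verts i)


open MeasureTheory

def stdTri : Set (ℝ × ℝ) := {z | 0 ≤ z.1 ∧ 0 ≤ z.2 ∧ z.1 + z.2 ≤ 1}

lemma stdTri_isClosed : IsClosed stdTri := by
  have h1 : IsClosed {z : ℝ × ℝ | 0 ≤ z.1} := isClosed_le (by fun_prop) (by fun_prop)
  have h2 : IsClosed {z : ℝ × ℝ | 0 ≤ z.2} := isClosed_le (by fun_prop) (by fun_prop)
  have h3 : IsClosed {z : ℝ × ℝ | z.1 + z.2 ≤ 1} := isClosed_le (by fun_prop) (by fun_prop)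
  exact h1.inter (h2.inter h3)

lemma stdTri_isCompact : IsCompact stdTri := by
  refine IsCompact.of_isClosed_subset (isCompact_Icc (a := ((0:ℝ),(0:ℝ))) (b := ((1:ℝ),(1:ℝ))))
    stdTri_isClosed ?_
  rintro ⟨x, y⟩ ⟨h1, h2, h3⟩
  simp only at h1 h2 h3
  exact ⟨⟨h1, h2⟩, ⟨by simp only; linarith, by simp only; linarith⟩⟩

lemma stdTri_volume : volume stdTri = ENNReal.ofReal (1 / 2) := by
  rw [Measure.volume_eq_prod, Measure.prod_apply stdTri_isClosed.measurableSet]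
  have h : ∀ x : ℝ, volume (Prod.mk x ⁻¹' stdTri) =
      (Set.Icc (0:ℝ) 1).indicator (fun x => ENNReal.ofReal (1 - x)) x := by
    intro x
    by_cases hx : x ∈ Set.Icc (0:ℝ) 1
    · rw [Set.indicator_of_mem hx]
      have : Prod.mk x ⁻¹' stdTri = Set.Icc 0 (1 - x) := by
        ext y
        simp only [stdTri, Set.mem_preimage, Set.mem_ofPred_eq, Set.mem_Icc]
        constructor
        · rintro ⟨h1, h2, h3⟩; exact ⟨h2, by linarith⟩
        · rintro ⟨h2, h3⟩; exact ⟨hx.1, h2, by linarith⟩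
      rw [this, Real.volume_Icc, sub_zero]
    · rw [Set.indicator_of_notMem hx]
      have : Prod.mk x ⁻¹' stdTri = ∅ := by
        ext y
        simp only [stdTri, Set.mem_preimage, Set.mem_ofPred_eq, Set.mem_empty_iff_false, iff_false]
        rintro ⟨h1, h2, h3⟩
        exact hx ⟨h1, by linarith⟩
      rw [this, measure_empty]
  simp_rw [h]
  rw [lintegral_indicator measurableSet_Icc, ← ofReal_integral_eq_lintegral_ofReal]
  · congr 1
    rw [integral_Icc_eq_integral_Ioc, ← intervalIntegral.integral_of_le zero_le_one]
    rw [intervalIntegral.integral_sub (by simp) (by simp)]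
    simp; norm_num
  · exact (Continuous.continuousOn (by fun_prop)).integrableOn_Icc
  · refine (ae_restrict_iff' measurableSet_Icc).2 (Filter.Eventually.of_forall ?_)
    intro x hx
    simp only [Pi.zero_apply]
    linarith [hx.2]

def linMap (u v : ℝ × ℝ) : (ℝ × ℝ) →ₗ[ℝ] (ℝ × ℝ) where
  toFun z := (z.1 * u.1 + z.2 * v.1, z.1 * u.2 + z.2 * v.2)
  map_add' a b := by ext <;> simp <;> ring
  map_smul' c a := by ext <;> simp <;> ring

lemma linMap_det (u v : ℝ × ℝ) : LinearMap.det (linMap u v) = det2 u v := by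
  rw [← LinearMap.det_toMatrix (Module.Basis.finTwoProd ℝ), Matrix.det_fin_two]
  simp [LinearMap.toMatrix_apply, linMap, det2]
  ring

def tri (u v : ℝ × ℝ) : Set (ℝ × ℝ) := linMap u v '' stdTri

lemma tri_volume (u v : ℝ × ℝ) : volume (tri u v) = ENNReal.ofReal (|det2 u v| / 2) := by
  rw [tri, Measure.addHaar_image_linearMap, linMap_det, stdTri_volume,
    ← ENNReal.ofReal_mul (abs_nonneg _)]
  congr 1; ring

lemma tri_measurable (u v : ℝ × ℝ) : MeasurableSet (tri u v) :=
  (stdTri_isCompact.image (linMap u v).continuous_of_finiteDimensional).isClosed.measurableSet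

def detMap (u : ℝ × ℝ) : (ℝ × ℝ) →ₗ[ℝ] ℝ where
  toFun z := det2 u z
  map_add' a b := by simp [det2]; ring
  map_smul' c a := by simp [det2]; ring

def line (u : ℝ × ℝ) : Set (ℝ × ℝ) := {z | det2 u z = 0}

lemma line_null {u : ℝ × ℝ} (hu : u ≠ 0) : volume (line u) = 0 := by
  have : line u = (LinearMap.ker (detMap u) : Set (ℝ × ℝ)) := by
    ext z; simp [line, detMap]
  rw [this]
  apply Measure.addHaar_submodule
  intro h
  apply hu
  have h1 : ((1:ℝ),(0:ℝ)) ∈ LinearMap.ker (detMap u) := by rw [h]; trivial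
  have h2 : ((0:ℝ),(1:ℝ)) ∈ LinearMap.ker (detMap u) := by rw [h]; trivial
  simp [detMap, det2] at h1 h2
  ext <;> simp [h1, h2]

def lexPos (u : ℝ × ℝ) : Prop := 0 < u.1 ∨ (u.1 = 0 ∧ 0 < u.2)

lemma lexPos.ne {u : ℝ × ℝ} (h : lexPos u) : u ≠ 0 := by
  rintro rfl
  rcases h with h | ⟨_, h⟩ <;> simp at h

lemma lexPos.nonneg {u : ℝ × ℝ} (h : lexPos u) : 0 ≤ u.1 := by
  rcases h with h | ⟨h, _⟩ <;> linarith

lemma det_trans {u v w : ℝ × ℝ} (hu : lexPos u) (hv : lexPos v) (hw : lexPos w)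
    (h1 : det2 u v ≤ 0) (h2 : det2 v w ≤ 0) : det2 u w ≤ 0 := by
  have key : v.1 * det2 u w = u.1 * det2 v w + w.1 * det2 u v := by simp only [det2]; ring
  rcases hv with hv | ⟨hv, hv'⟩
  · have a := mul_nonneg hu.nonneg (neg_nonneg.2 h2)
    have b := mul_nonneg hw.nonneg (neg_nonneg.2 h1)
    by_contra hc
    have := mul_pos hv (not_le.1 hc)
    linarith
  · have hw0 := hw.nonneg
    have hu0 := hu.nonneg
    simp only [det2, hv] at *
    have : u.1 = 0 := by
      by_contra hc
      have : 0 < u.1 := lt_of_le_of_ne hu0 (Ne.symm hc)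
      have := mul_pos this hv'
      linarith
    rcases hu with hu | ⟨_, hu⟩
    · linarith
    · have := mul_nonneg hu.le hw0
      rw [‹u.1 = 0›]; linarith

lemma det_par {u v q : ℝ × ℝ} (hu : lexPos u) (hv : lexPos v)
    (h : det2 u v = 0) (h1 : det2 u q < 0) (h2 : 0 ≤ det2 v q) : False := by
  have k1 : v.1 * det2 u q = u.1 * det2 v q + q.1 * det2 u v := by simp only [det2]; ring
  have k2 : v.2 * det2 u q = u.2 * det2 v q + q.2 * det2 u v := by simp only [det2]; ring
  rw [h] at k1 k2
  rcases hv with hv | ⟨hv, hv'⟩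
  · have := mul_neg_of_pos_of_neg hv h1
    have := mul_nonneg hu.nonneg h2
    linarith
  · have := mul_neg_of_pos_of_neg hv' h1
    have hu1 : u.1 = 0 := by
      simp only [det2, hv, mul_zero, sub_zero] at h
      rcases mul_eq_zero.1 h with h | h
      · exact h
      · linarith
    rcases hu with hu | ⟨_, hu⟩
    · linarith
    · have := mul_nonneg hu.le h2
      linarith

lemma det_linMap (u v w z : ℝ × ℝ) :
    det2 w (linMap u v z) = z.1 * det2 w u + z.2 * det2 w v := by
  simp only [linMap, det2, LinearMap.coe_mk, AddHom.coe_mk]; ring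

lemma mem_tri {u v q : ℝ × ℝ} (hD : det2 u v < 0) (h1 : det2 u q ≤ 0) (h2 : 0 ≤ det2 v q)
    (h3 : det2 (v - u) (q - u) ≤ 0) : q ∈ tri u v := by
  have hD' : det2 u v ≠ 0 := hD.ne
  refine ⟨(-det2 v q / det2 u v, det2 u q / det2 u v), ⟨?_, ?_, ?_⟩, ?_⟩
  · exact div_nonneg_of_nonpos (by linarith) hD.le
  · exact div_nonneg_of_nonpos h1 hD.le
  · simp only
    rw [← add_div, div_le_one_of_neg hD]
    have : det2 (v - u) (q - u) = det2 v q - det2 u q + det2 u v := by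
      simp only [det2, Prod.fst_sub, Prod.snd_sub]; ring
    linarith
  · ext
    · simp only [linMap, LinearMap.coe_mk, AddHom.coe_mk]
      field_simp
      simp only [det2]; ring
    · simp only [linMap, LinearMap.coe_mk, AddHom.coe_mk]
      field_simp
      simp only [det2]; ring

/-- Fan decomposition. -/
lemma fan_volume (n : ℕ) (hn : 2 ≤ n) (w : ℕ → ℝ × ℝ) (S : Set (ℝ × ℝ)) (hS : Convex ℝ S)
    (hwS : ∀ k, w k ∈ S) (h0 : w 0 = 0) (hn0 : w n = 0)
    (hpos : ∀ k, 0 < k → k < n → lexPos (w k))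
    (hedge : ∀ k, ∀ q ∈ S, det2 (w (k + 1) - w k) (q - w k) ≤ 0) :
    volume S = ENNReal.ofReal (∑ k ∈ Finset.range n, -det2 (w k) (w (k + 1)) / 2) := by
  have h0S : (0 : ℝ × ℝ) ∈ S := h0 ▸ hwS 0
  have hcons : ∀ k, det2 (w k) (w (k + 1)) ≤ 0 := by
    intro k
    have := hedge k 0 h0S
    simp only [det2, Prod.fst_sub, Prod.snd_sub, Prod.fst_zero, Prod.snd_zero] at *
    linarith
  have hfan : ∀ j, 0 < j → ∀ k, j ≤ k → k < n → det2 (w j) (w k) ≤ 0 := by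
    intro j hj k hjk
    induction k, hjk using Nat.le_induction with
    | base => intro _; simp only [det2]; linarith
    | succ k hjk ih =>
      intro hk
      exact det_trans (hpos j hj (by omega)) (hpos k (by omega) (by omega))
        (hpos (k + 1) (by omega) hk) (ih (by omega)) (hcons k)
  have hfan' : ∀ j, 0 < j → ∀ k, j ≤ k → k ≤ n → det2 (w j) (w k) ≤ 0 := by
    intro j hj k hjk hk
    rcases hk.lt_or_eq with hk | rfl
    · exact hfan j hj k hjk hk
    · rw [hn0]; simp [det2]
  have hsub : ∀ k, tri (w k) (w (k + 1)) ⊆ S := by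
    rintro k _ ⟨z, ⟨h1, h2, h3⟩, rfl⟩
    have := hS.sum_mem (t := Finset.univ) (w := ![1 - z.1 - z.2, z.1, z.2])
      (z := ![0, w k, w (k + 1)])
      (by intro i _; fin_cases i <;> simp <;> linarith)
      (by simp [Fin.sum_univ_three]; ring)
      (by intro i _; fin_cases i <;> simp [h0S, hwS])
    convert this using 1
    ext <;> simp [Fin.sum_univ_three, linMap]
  have hcover : ∀ q ∈ S, ∀ m, 1 ≤ m → m < n → 0 ≤ det2 (w m) q →
      (∃ j < n, q ∈ tri (w j) (w (j + 1))) ∨ q ∈ line (w 1) := by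
    intro q hq m hm
    induction m, hm using Nat.le_induction with
    | base =>
      intro _ h
      right
      have := hedge 0 q hq
      simp only [h0, sub_zero, zero_add] at this
      exact le_antisymm this h
    | succ m hm ih =>
      intro hmn h
      rcases le_or_gt 0 (det2 (w m) q) with h' | h'
      · exact ih (by omega) h'
      · left
        refine ⟨m, by omega, mem_tri ?_ h'.le h (hedge m q hq)⟩
        refine lt_of_le_of_ne (hcons m) fun hD => ?_
        exact det_par (hpos m (by omega) (by omega)) (hpos (m + 1) (by omega) hmn) hD h' h
  have hlast : ∀ q ∈ S, 0 ≤ det2 (w (n - 1)) q := by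
    intro q hq
    have := hedge (n - 1) q hq
    rw [Nat.sub_add_cancel (by omega : 1 ≤ n), hn0] at this
    simp only [det2, Prod.fst_sub, Prod.snd_sub, Prod.fst_zero, Prod.snd_zero] at *
    linarith
  set U : Set (ℝ × ℝ) := ⋃ k ∈ Finset.range n, tri (w k) (w (k + 1)) with hU
  have hUS : U ⊆ S := Set.iUnion₂_subset fun k _ => hsub k
  have hSU : S ⊆ U ∪ line (w 1) := by
    intro q hq
    rcases hcover q hq (n - 1) (by omega) (by omega) (hlast q hq) with ⟨j, hj, h⟩ | h
    · left
      exact Set.mem_biUnion (Finset.mem_coe.2 (Finset.mem_range.2 hj)) h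
    · right; exact h
  have hvol : volume S = volume U := by
    apply le_antisymm
    · calc volume S ≤ volume (U ∪ line (w 1)) := measure_mono hSU
        _ ≤ volume U + volume (line (w 1)) := measure_union_le _ _
        _ = volume U := by rw [line_null (hpos 1 (by omega) (by omega)).ne, add_zero]
    · exact measure_mono hUS
  have hdisj : ∀ j k, j < k → k < n →
      AEDisjoint volume (tri (w j) (w (j + 1))) (tri (w k) (w (k + 1))) := by
    intro j k hjk hk
    refine measure_mono_null ?_ (line_null (hpos (j + 1) (by omega) (by omega)).ne)
    rintro q ⟨⟨z, ⟨h1, h2, h3⟩, hz⟩, ⟨z', ⟨h1', h2', h3'⟩, hz'⟩⟩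
    have a := det_linMap (w j) (w (j + 1)) (w (j + 1)) z
    have b := det_linMap (w k) (w (k + 1)) (w (j + 1)) z'
    rw [hz] at a
    rw [hz'] at b
    have c1 : det2 (w (j + 1)) (w j) = - det2 (w j) (w (j + 1)) := by simp only [det2]; ring
    have c2 : det2 (w (j + 1)) (w (j + 1)) = 0 := by simp only [det2]; ring
    rw [c1, c2] at a
    have d0 := mul_nonneg h1 (neg_nonneg.2 (hcons j))
    have d1 := mul_nonneg h1' (neg_nonneg.2 (hfan' (j + 1) (by omega) k (by omega) (by omega)))
    have d2 := mul_nonneg h2'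
      (neg_nonneg.2 (hfan' (j + 1) (by omega) (k + 1) (by omega) (by omega)))
    show det2 (w (j + 1)) q = 0
    apply le_antisymm <;> linarith
  rw [hvol, hU, measure_biUnion_finset₀, ENNReal.ofReal_sum_of_nonneg]
  · refine Finset.sum_congr rfl fun k _ => ?_
    rw [tri_volume, abs_of_nonpos (hcons k)]
  · intro k _
    have := hcons k
    linarith
  · intro j hj k hk hjk
    have hj := Finset.mem_range.1 (Finset.mem_coe.1 hj)
    have hk := Finset.mem_range.1 (Finset.mem_coe.1 hk)
    rcases lt_or_gt_of_ne hjk with h | h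
    · exact hdisj j k h hk
    · exact (hdisj k j h hj).symm
  · exact fun k _ => (tri_measurable _ _).nullMeasurableSet

lemma sum_shift (f : ℕ → ℝ) (n : ℕ) (hf : ∀ i, f (i + n) = f i) (s : ℕ) :
    ∑ i ∈ Finset.range n, f (s + i) = ∑ i ∈ Finset.range n, f i := by
  induction s with
  | zero => simp
  | succ s ih =>
    rw [← ih]
    have a := Finset.sum_range_succ (fun i => f (s + i)) n
    have b := Finset.sum_range_succ' (fun i => f (s + i)) n
    simp only [hf, add_zero] at a b
    have : ∀ i, f (s + 1 + i) = f (s + (i + 1)) := fun i => by congr 1; ring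
    simp only [this]
    linarith

lemma omegaLen_edge (P : ClockPolygon) (i : ℕ) :
    omegaLen P.body (P.verts (i + 1) - P.verts i) =
      det2 (P.verts (i + 1) - P.verts i) (P.verts i) := by
  apply IsGreatest.csSup_eq
  refine ⟨⟨P.verts i, subset_convexHull ℝ _ ⟨i, rfl⟩, rfl⟩, ?_⟩
  rintro _ ⟨q, hq, rfl⟩
  have := P.clockwise i q hq
  simp only [det2, Prod.fst_sub, Prod.snd_sub] at *
  linarith

/-- For every compact convex polygon `Ω` with nonempty
interior, `ℓ_Ω(∂Ω) = 2·vol(Ω)`. -/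
theorem omegaPerim_self_eq_two_vol (P : ClockPolygon)
    (hP : (interior P.body).Nonempty) :
    omegaPerim P.body P = 2 * (MeasureTheory.volume P.body).toReal := by
  have hmod : ∀ k, P.verts (k % P.n) = P.verts k := fun k =>
    Function.Periodic.map_mod_nat (f := P.verts) P.periodic k
  have hn : 2 ≤ P.n := by
    by_contra hlt
    have h1 : P.n = 1 := by have := P.npos; omega
    have hr : Set.range P.verts = {P.verts 0} := by
      ext q
      constructor
      · rintro ⟨k, rfl⟩
        have := hmod k
        rw [h1, Nat.mod_one] at this
        exact this.symm
      · rintro rfl; exact ⟨0, rfl⟩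
    rw [ClockPolygon.body, hr, convexHull_singleton, interior_singleton] at hP
    exact Set.not_nonempty_empty hP
  obtain ⟨s, hs, hmin⟩ := Finset.exists_min_image (Finset.range P.n)
    (fun i => toLex (P.verts i)) ⟨0, Finset.mem_range.2 P.npos⟩
  have hs := Finset.mem_range.1 hs
  set w : ℕ → ℝ × ℝ := fun k => P.verts (s + k) - P.verts s with hw
  have hwn : w P.n = 0 := by simp [hw, P.periodic]
  have hpos : ∀ k, 0 < k → k < P.n → lexPos (w k) := by
    intro k hk hkn
    have hlt : (s + k) % P.n < P.n := Nat.mod_lt _ P.npos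
    have hle := hmin ((s + k) % P.n) (Finset.mem_range.2 hlt)
    simp only [hmod] at hle
    have hne : P.verts s ≠ P.verts (s + k) := by
      intro h
      rw [← hmod (s + k)] at h
      have h := P.inj _ _ hs hlt h
      rcases lt_or_ge (s + k) P.n with h' | h'
      · rw [Nat.mod_eq_of_lt h'] at h; omega
      · rw [Nat.mod_eq_sub_mod h', Nat.mod_eq_of_lt (by omega)] at h; omega
    rw [Prod.Lex.toLex_le_toLex] at hle
    simp only [lexPos, hw, Prod.fst_sub, Prod.snd_sub]
    rcases hle with h | ⟨h, h'⟩
    · left; linarith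
    · right
      refine ⟨by linarith, ?_⟩
      have : (P.verts s).2 ≠ (P.verts (s + k)).2 := fun h2 => hne (Prod.ext h h2)
      have := lt_of_le_of_ne h' this
      linarith
  set S : Set (ℝ × ℝ) := (fun q => q + P.verts s) ⁻¹' P.body with hSdef
  have hvolS : volume S = volume P.body := measure_preimage_add_right _ _ _
  have hmain := fan_volume P.n hn w S
    ((convex_convexHull ℝ _).translate_preimage_left _)
    (fun k => by
      simp only [hSdef, hw, Set.mem_preimage, sub_add_cancel]
      exact subset_convexHull ℝ _ ⟨_, rfl⟩)
    (by simp [hw]) hwn hpos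
    (by
      intro k q hq
      have := P.clockwise (s + k) _ hq
      convert this using 2
      · simp only [hw, sub_sub_sub_cancel_right, add_assoc]
      · simp only [hw]; abel)
  have hnonneg : 0 ≤ ∑ k ∈ Finset.range P.n, -det2 (w k) (w (k + 1)) / 2 := by
    apply Finset.sum_nonneg
    intro k _
    have := P.clockwise (s + k) (P.verts s) (subset_convexHull ℝ _ ⟨_, rfl⟩)
    simp only [hw, det2, Prod.fst_sub, Prod.snd_sub, ← add_assoc] at *
    linarith
  rw [← hvolS, hmain, ENNReal.toReal_ofReal hnonneg, omegaPerim]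
  simp only [omegaLen_edge]
  rw [← sum_shift _ P.n (by
    intro i
    have : P.verts (i + P.n + 1) = P.verts (i + 1) := by
      rw [show i + P.n + 1 = i + 1 + P.n by ring, P.periodic]
    rw [this, P.periodic]) s]
  have htel := Finset.sum_range_sub (fun k => det2 (w k) (P.verts s)) P.n
  have hw0 : w 0 = 0 := by simp [hw]
  rw [hwn, hw0, sub_self] at htel
  rw [Finset.mul_sum, ← add_zero (∑ i ∈ Finset.range P.n, 2 * _), ← htel,
    ← Finset.sum_add_distrib]
  refine Finset.sum_congr rfl fun k _ => ?_
  simp only [hw, det2, Prod.fst_sub, Prod.snd_sub, ← add_assoc]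
  ring

end
end
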